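/- Let n > 2 and B = [[A, u],[w*, c]] be a unitary n×n matrix where A is (n−1)×(n−1), u, w ∈ ℂ^{n−1}, c ∈ ℂ. Then B = B* if and only if: A = A*, u = w, c ∈ ℝ, ‖u‖² + |c|² = 1, A² + ‖u‖² P_u = I_{n−1}, and (A + c I_{n−1}) u = 0. -/

import Mathlib

open Matrix

/-- The block matrix `B = [[A, u],[w*, c]]` acting on `ℂⁿ = ℂ^{n-1} ⊕ ℂ`:
upper-left corner `A`, last column `(u; c)`, bottom row `(w*, c)`. -/
noncomputable def blockB2 {m : ℕ} (A : Matrix (Fin m) (Fin m) ℂ) (u : Fin m → ℂ)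
    (w : Fin m → ℂ) (c : ℂ) : Matrix (Fin (m + 1)) (Fin (m + 1)) ℂ :=
  fun i j =>
    Fin.lastCases
      (Fin.lastCases c (fun j' => (starRingEnd ℂ) (w j')) j)
      (fun i' => Fin.lastCases (u i') (fun j' => A i' j') j) i

/-- The orthogonal projection of `ℂ^m` onto the line `ℂx` (zero when `x = 0`). -/
noncomputable def projLine {m : ℕ} (x : Fin m → ℂ) : Matrix (Fin m) (Fin m) ℂ :=
  if x = 0 then 0 else (star x ⬝ᵥ x)⁻¹ • Matrix.vecMulVec x (star x)

open scoped ComplexOrder in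
theorem smul_projLine_aux {m : ℕ} (x : Fin m → ℂ) :
    (star x ⬝ᵥ x) • projLine x = Matrix.vecMulVec x (star x) := by
  unfold projLine
  split_ifs with h
  · subst h
    ext i j
    simp [Matrix.vecMulVec_apply]
  · rw [smul_smul, mul_inv_cancel₀, one_smul]
    intro h0
    exact h (dotProduct_star_self_eq_zero.mp h0)

theorem blockB2_aux {m : ℕ} (A : Matrix (Fin m) (Fin m) ℂ) (u w : Fin m → ℂ) (c : ℂ) :
    (∀ i j, blockB2 A u w c (Fin.castSucc i) (Fin.castSucc j) = A i j) ∧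
    (∀ i, blockB2 A u w c (Fin.castSucc i) (Fin.last m) = u i) ∧
    (∀ j, blockB2 A u w c (Fin.last m) (Fin.castSucc j) = (starRingEnd ℂ) (w j)) ∧
    blockB2 A u w c (Fin.last m) (Fin.last m) = c := by
  simp [blockB2]

/-- For `n > 2` and a unitary `B = [[A, u],[w*, c]]`: `B = B*` iff `A = A*`, `u = w`,
`c ∈ ℝ`, `‖u‖² + |c|² = 1`, `A² + ‖u‖² P_u = I`, and `(A + cI)u = 0`. -/
theorem stmt_13 {m : ℕ} (hm : 2 ≤ m) (A : Matrix (Fin m) (Fin m) ℂ)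
    (u w : Fin m → ℂ) (c : ℂ)
    (hB : blockB2 A u w c ∈ Matrix.unitaryGroup (Fin (m + 1)) ℂ) :
    (blockB2 A u w c)ᴴ = blockB2 A u w c ↔
      (Aᴴ = A ∧ u = w ∧ c.im = 0 ∧
       star u ⬝ᵥ u + (Complex.normSq c : ℂ) = 1 ∧
       A * A + (star u ⬝ᵥ u) • projLine u = 1 ∧
       (A + c • 1) *ᵥ u = 0) := by
  obtain ⟨b1, b2, b3, b4⟩ := blockB2_aux A u w c
  rw [smul_projLine_aux]
  constructor
  · intro h
    have hBB : blockB2 A u w c * blockB2 A u w c = 1 := by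
      have h1 := Matrix.mem_unitaryGroup_iff.mp hB
      rwa [Matrix.star_eq_conjTranspose, h] at h1
    have e := fun i j => congrFun (congrFun h i) j
    have hA : Aᴴ = A := by
      ext i j
      have := e (Fin.castSucc i) (Fin.castSucc j)
      simpa only [Matrix.conjTranspose_apply, b1] using this
    have huw : u = w := by
      ext i
      have := e (Fin.castSucc i) (Fin.last m)
      simp only [Matrix.conjTranspose_apply, b2, b3] at this
      simpa using this.symm
    have hc : (starRingEnd ℂ) c = c := by
      have := e (Fin.last m) (Fin.last m)
      simp only [Matrix.conjTranspose_apply, b4] at this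
      exact this
    have f := fun i j => congrFun (congrFun hBB i) j
    simp only [Matrix.mul_apply, Fin.sum_univ_castSucc] at f
    subst huw
    refine ⟨hA, rfl, Complex.conj_eq_iff_im.mp hc, ?_, ?_, ?_⟩
    · have := f (Fin.last m) (Fin.last m)
      simp only [b2, b3, b4, Matrix.one_apply_eq] at this
      rw [← this, Complex.normSq_eq_conj_mul_self, hc]
      rfl
    · ext i j
      have := f (Fin.castSucc i) (Fin.castSucc j)
      simp only [b1, b2, b3] at this
      rw [Matrix.add_apply, Matrix.mul_apply, Matrix.vecMulVec_apply]
      refine Eq.trans this ?_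
      simp [Matrix.one_apply]
    · ext i
      have := f (Fin.castSucc i) (Fin.last m)
      simp only [b1, b2, b4] at this
      rw [Matrix.one_apply_ne (Fin.castSucc_lt_last i).ne] at this
      rw [Matrix.add_mulVec, Matrix.smul_mulVec, Matrix.one_mulVec]
      simp only [Pi.add_apply, Pi.smul_apply, smul_eq_mul, Matrix.mulVec, dotProduct, Pi.zero_apply]
      rw [mul_comm c]
      exact this
  · rintro ⟨hA, huw, hc, -, -, -⟩
    subst huw
    ext i j
    rw [Matrix.conjTranspose_apply]
    induction i using Fin.lastCases with
    | last =>
      induction j using Fin.lastCases with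
      | last => rw [b4]; exact Complex.conj_eq_iff_im.mpr hc
      | cast j => rw [b2, b3]; rfl
    | cast i =>
      induction j using Fin.lastCases with
      | last => rw [b2, b3]; simp
      | cast j =>
        rw [b1, b1]
        exact congrFun (congrFun hA i) j
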